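/- Let G = (V ∪ ℒ, D) be a latent-factor graph and fix a node v ∈ V, a set H ⊆ ℒ, and a set Z ⊆ ch(H) ∖ ({v} ∪ pa_V(v)) with |Z| = |H|. Let A = V ∖ (Z ∪ {v} ∪ ch(pa_ℒ(Z ∪ {v}) ∖ H)) be the set of allowed nodes. Then there exist |pa_V(v)| + |Z| simple directed paths from s to t in the flow graph G_flow(v, A, Z) that pairwise share no vertex other than s and t (equivalently, the maximum s–t flow in G_flow(v, A, Z) with unit vertex capacities on all vertices other than s and t equals |pa_V(v)| + |Z|), if and only if there exists a set Y ⊆ A such that the triple (Y, Z, H) satisfies the latent-factor half-trek criterion with respect to v. -/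

import Mathlib

open scoped Classical
open Matrix

namespace LFG

variable {V L : Type*} [DecidableEq V] [DecidableEq L]

/-- Observed parents of a node `v`: nodes `w` with `w → v` in `D_V`. -/
def paV (DV : Finset (V × V)) (v : V) : Finset V :=
  (DV.filter fun e => e.2 = v).image Prod.fst

/-- Latent parents of a set `W` of observed nodes. -/
def paL (DLV : Finset (L × V)) (W : Finset V) : Finset L :=
  (DLV.filter fun e => e.2 ∈ W).image Prod.fst

/-- Observed children of a set `H` of latent nodes. -/
def chL (DLV : Finset (L × V)) (H : Finset L) : Finset V :=
  (DLV.filter fun e => e.1 ∈ H).image Prod.snd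

/-- A latent-factor half-trek: either a directed path
`source → x₁ → ⋯ → xₙ → target` (when `latent = none`, with node list
`source :: tail`), or `source ← h → x₁ → ⋯ → xₙ → target`
(when `latent = some h`, with observed node list `tail ≠ []`).
Trivial half-treks (`latent = none`, `tail = []`) are allowed. -/
structure HalfTrek (DV : Finset (V × V)) (DLV : Finset (L × V)) where
  source : V
  latent : Option L
  tail : List V
  chain : List.Chain' (fun a b => (a, b) ∈ DV) tail
  src_edge : latent = none → ∀ x ∈ tail.head?, (source, x) ∈ DV
  latent_src : ∀ h, latent = some h → (h, source) ∈ DLV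
  latent_head : ∀ h, latent = some h → ∃ x, tail.head? = some x ∧ (h, x) ∈ DLV

variable {DV : Finset (V × V)} {DLV : Finset (L × V)}

/-- The target of a half-trek. -/
def HalfTrek.target (t : HalfTrek DV DLV) : V := t.tail.getLastD t.source

/-- Observed part of the left-hand side of a half-trek. -/
def HalfTrek.leftV (t : HalfTrek DV DLV) : Finset V := {t.source}

/-- Latent node of a half-trek (both on its left- and right-hand side). -/
def HalfTrek.lats (t : HalfTrek DV DLV) : Finset L := t.latent.toFinset

/-- Observed part of the right-hand side of a half-trek. -/
def HalfTrek.rightV (t : HalfTrek DV DLV) : Finset V :=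
  match t.latent with
  | none => insert t.source t.tail.toFinset
  | some _ => t.tail.toFinset

/-- The half-trek avoids all latent nodes in `H`. -/
def HalfTrek.Avoids (t : HalfTrek DV DLV) (H : Finset L) : Prop :=
  ∀ h, t.latent = some h → h ∉ H

/-- `w` is half-trek reachable from `u` while avoiding `H` (for distinct `u ≠ w`). -/
def HtrFrom (DV : Finset (V × V)) (DLV : Finset (L × V)) (H : Finset L) (u w : V) : Prop :=
  u ≠ w ∧ ∃ t : HalfTrek DV DLV, t.source = u ∧ t.target = w ∧ t.Avoids H

/-- `w ∈ htr_H(U)`. -/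
def HtrReach (DV : Finset (V × V)) (DLV : Finset (L × V)) (H : Finset L)
    (U : Finset V) (w : V) : Prop :=
  ∃ u ∈ U, HtrFrom DV DLV H u w

/-- Two half-treks have no sided intersection. -/
def NSI (t₁ t₂ : HalfTrek DV DLV) : Prop :=
  Disjoint t₁.leftV t₂.leftV ∧ Disjoint t₁.lats t₂.lats ∧ Disjoint t₁.rightV t₂.rightV

/-- A system of latent-factor half-treks with no sided intersection from `Y` to `T`,
indexed by targets. -/
def IsHTSystem (DV : Finset (V × V)) (DLV : Finset (L × V)) (Y T : Finset V)
    (f : V → HalfTrek DV DLV) : Prop :=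
  (∀ b ∈ T, (f b).target = b) ∧
  T.image (fun b => (f b).source) = Y ∧
  ∀ b₁ ∈ T, ∀ b₂ ∈ T, b₁ ≠ b₂ → NSI (f b₁) (f b₂)

/-- The triple `(Y, Z, H)` satisfies the latent-factor half-trek criterion (LF-HTC)
with respect to `v`. -/
def SatisfiesLFHTC (DV : Finset (V × V)) (DLV : Finset (L × V)) (v : V)
    (Y Z : Finset V) (H : Finset L) : Prop :=
  v ∉ Y ∧ v ∉ Z ∧
  Y.card = (paV DV v).card + H.card ∧
  Z.card = H.card ∧
  Disjoint Z (paV DV v) ∧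
  Disjoint Y (insert v Z) ∧
  (paL DLV Y ∩ paL DLV (insert v Z) ⊆ H) ∧
  ∃ f : V → HalfTrek DV DLV,
    IsHTSystem DV DLV Y (Z ∪ paV DV v) f ∧
    ∀ z ∈ Z, ∃ h ∈ H, (f z).latent = some h ∧ (f z).tail = [z]

section Matrices

variable [Fintype V] [Fintype L]

/-- The observed covariance matrix `Σ = (I-Λ)^{-⊤} (Ω_diag + Γ^⊤Γ) (I-Λ)^{-1}`. -/
noncomputable def SigmaMat (Λ : Matrix V V ℝ) (Γ : Matrix L V ℝ) (ω : V → ℝ) :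
    Matrix V V ℝ :=
  ((1 - Λ)ᵀ)⁻¹ * (Matrix.diagonal ω + Γᵀ * Γ) * (1 - Λ)⁻¹

/-- The parameters `(Λ, Γ, Ω_diag)` belong to `ℝ^{D_V}_reg × ℝ^{D_{ℒV}} × diag⁺_d`. -/
def GoodParams (DV : Finset (V × V)) (DLV : Finset (L × V))
    (Λ : Matrix V V ℝ) (Γ : Matrix L V ℝ) (ω : V → ℝ) : Prop :=
  (∀ a b : V, (a, b) ∉ DV → Λ a b = 0) ∧
  IsUnit (1 - Λ) ∧
  (∀ h a, (h, a) ∉ DLV → Γ h a = 0) ∧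
  (∀ a, 0 < ω a)

/-- Index type for the free parameter coordinates of `(Λ, Γ, Ω_diag)`. -/
abbrev ParamVar (DV : Finset (V × V)) (DLV : Finset (L × V)) : Type _ :=
  {e : V × V // e ∈ DV} ⊕ {e : L × V // e ∈ DLV} ⊕ V

/-- Evaluation of the parameter coordinates. -/
def evalParam (DV : Finset (V × V)) (DLV : Finset (L × V))
    (Λ : Matrix V V ℝ) (Γ : Matrix L V ℝ) (ω : V → ℝ) : ParamVar DV DLV → ℝ
  | Sum.inl e => Λ e.1.1 e.1.2
  | Sum.inr (Sum.inl e) => Γ e.1.1 e.1.2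
  | Sum.inr (Sum.inr a) => ω a

/-- Evaluation of the entries of `Σ`. -/
noncomputable def sigmaEval (Λ : Matrix V V ℝ) (Γ : Matrix L V ℝ) (ω : V → ℝ) :
    V × V → ℝ := fun e => SigmaMat Λ Γ ω e.1 e.2

/-- The direct effect `λ_{wv}` (the edge `w → v`) is rationally identifiable. -/
def RatIdent (DV : Finset (V × V)) (DLV : Finset (L × V)) (w v : V) : Prop :=
  ∃ (p q : MvPolynomial (V × V) ℝ) (g : MvPolynomial (ParamVar DV DLV) ℝ),
    g ≠ 0 ∧
    ∀ (Λ : Matrix V V ℝ) (Γ : Matrix L V ℝ) (ω : V → ℝ),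
      GoodParams DV DLV Λ Γ ω →
      MvPolynomial.eval (evalParam DV DLV Λ Γ ω) g ≠ 0 →
      MvPolynomial.eval (sigmaEval Λ Γ ω) q ≠ 0 ∧
      Λ w v * MvPolynomial.eval (sigmaEval Λ Γ ω) q
        = MvPolynomial.eval (sigmaEval Λ Γ ω) p

/-- The entry `Ω_{ij}` of the latent covariance matrix is rationally identifiable. -/
def OmegaIdent (DV : Finset (V × V)) (DLV : Finset (L × V)) (i j : V) : Prop :=
  ∃ (p q : MvPolynomial (V × V) ℝ) (g : MvPolynomial (ParamVar DV DLV) ℝ),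
    g ≠ 0 ∧
    ∀ (Λ : Matrix V V ℝ) (Γ : Matrix L V ℝ) (ω : V → ℝ),
      GoodParams DV DLV Λ Γ ω →
      MvPolynomial.eval (evalParam DV DLV Λ Γ ω) g ≠ 0 →
      MvPolynomial.eval (sigmaEval Λ Γ ω) q ≠ 0 ∧
      (Matrix.diagonal ω + Γᵀ * Γ) i j * MvPolynomial.eval (sigmaEval Λ Γ ω) q
        = MvPolynomial.eval (sigmaEval Λ Γ ω) p

end Matrices

end LFG

namespace LFG

/-- Nodes of the flow graph `G_flow(v, A, Z)`: a source `s`, a sink `t`, and two copies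
(`orig` and `copy`) of the observed and latent nodes. -/
inductive FlowNode (V L : Type) where
  | s : FlowNode V L
  | t : FlowNode V L
  | orig : V ⊕ L → FlowNode V L
  | copy : V ⊕ L → FlowNode V L
deriving DecidableEq

variable {V L : Type} [DecidableEq V] [DecidableEq L]

/-- The edges of the flow graph `G_flow(v, A, Z)`. -/
def FlowEdge (DV : Finset (V × V)) (DLV : Finset (L × V)) (v : V) (A Z : Finset V)
    (x y : FlowNode V L) : Prop :=
  match x, y with
  | .s, .orig (Sum.inl a) => a ∈ A
  | .orig (Sum.inl a), .orig (Sum.inr h) => a ∈ A ∧ (h, a) ∈ DLV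
  | .orig (Sum.inl a), .copy (Sum.inl b) => a = b ∧ a ∈ A
  | .orig (Sum.inr h), .copy (Sum.inr h') => h = h'
  | .copy (Sum.inr h), .copy (Sum.inl w) => (h, w) ∈ DLV
  | .copy (Sum.inl u), .copy (Sum.inl w) => (u, w) ∈ DV ∧ w ∉ Z
  | .copy (Sum.inl w), .t => w ∈ paV DV v ∨ w ∈ Z
  | _, _ => False

/-- A simple directed path from `s` to `t` in the flow graph. -/
def IsSTPath (DV : Finset (V × V)) (DLV : Finset (L × V)) (v : V) (A Z : Finset V)
    (p : List (FlowNode V L)) : Prop :=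
  List.Chain' (FlowEdge DV DLV v A Z) p ∧
  p.head? = some FlowNode.s ∧ p.getLast? = some FlowNode.t ∧ p.Nodup

end LFG

namespace LFG

/-- Loop erasure: a nonempty walk can be shortened to a simple walk with the same ends. -/
lemma exists_nodup_isChain {α : Type*} {R : α → α → Prop} (l : List α) (hl : l.IsChain R) :
    ∃ l' : List α, l'.IsChain R ∧ l'.head? = l.head? ∧ l'.getLast? = l.getLast? ∧
      l'.Nodup ∧ l' ⊆ l := by
  induction l with
  | nil => exact ⟨[], by simp⟩
  | cons a l ih =>
    obtain ⟨l', hc, hh, hg, hn, hs⟩ := ih hl.tail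
    by_cases ha : a ∈ l'
    · obtain ⟨u, w, rfl⟩ := List.append_of_mem ha
      refine ⟨a :: w, (List.isChain_append.1 hc).2.1, rfl, ?_, (List.nodup_append.1 hn).2.1, ?_⟩
      · cases l with
        | nil => simp at hs
        | cons b l => rw [List.getLast?_cons_cons, ← hg, List.getLast?_append_of_ne_nil _ (by simp)]
      · intro x hx
        have := @hs x
        grind
    · refine ⟨a :: l', ?_, rfl, ?_, by simp [ha, hn], by grind⟩
      · rw [List.isChain_cons] at hl ⊢
        rw [hh]
        exact ⟨hl.1, hc⟩
      · simp only [List.getLast?_cons, hg]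

section FlowPaths

variable {V L : Type} [DecidableEq V]
  {DV : Finset (V × V)} {DLV : Finset (L × V)} {v : V} {A Z : Finset V}

lemma mem_rightV_of_mem_tail {τ : HalfTrek DV DLV} {w : V} (hw : w ∈ τ.tail) :
    w ∈ τ.rightV := by
  unfold HalfTrek.rightV
  split <;> simp [hw]

lemma mem_paL [DecidableEq L] {W : Finset V} {h : L} :
    h ∈ paL DLV W ↔ ∃ w ∈ W, (h, w) ∈ DLV := by
  simp [paL, and_comm]

lemma mem_chL [DecidableEq L] {K : Finset L} {w : V} :
    w ∈ chL DLV K ↔ ∃ h ∈ K, (h, w) ∈ DLV := by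
  simp [chL, and_comm]

/-- The copied part of a flow path projects to a directed path of observed nodes. -/
lemma exists_observed_path (l : List (FlowNode V L)) (w : V)
    (hc : (FlowNode.copy (Sum.inl w) :: l).IsChain (FlowEdge DV DLV v A Z))
    (hl : (FlowNode.copy (Sum.inl w) :: l).getLast? = some FlowNode.t) :
    ∃ ws : List V, (w :: ws).IsChain (fun a b => (a, b) ∈ DV) ∧ (∀ x ∈ ws, x ∉ Z) ∧
      (∀ x ∈ ws, FlowNode.copy (Sum.inl x) ∈ l) ∧
      (ws.getLastD w ∈ paV DV v ∨ ws.getLastD w ∈ Z) := by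
  induction l generalizing w with
  | nil => simp at hl
  | cons y l ih =>
    rw [List.isChain_cons_cons] at hc
    rw [List.getLast?_cons_cons] at hl
    obtain ⟨he, hc⟩ := hc
    match y with
    | .s => simp [FlowEdge] at he
    | .orig _ => simp [FlowEdge] at he
    | .t => exact ⟨[], by simp, by simp, by simp, by simpa [FlowEdge] using he⟩
    | .copy (Sum.inr _) => simp [FlowEdge] at he
    | .copy (Sum.inl u) =>
      obtain ⟨ws, h1, h2, h3, h4⟩ := ih u hc hl
      simp only [FlowEdge] at he
      refine ⟨u :: ws, List.isChain_cons_cons.2 ⟨he.1, h1⟩, ?_, ?_, ?_⟩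
      · simpa [he.2] using h2
      · intro x hx
        rcases List.mem_cons.1 hx with rfl | hx
        · simp
        · exact List.mem_cons_of_mem _ (h3 x hx)
      · simpa only [List.getLastD_cons] using h4

/-- Every `s`–`t` path of the flow graph traces a latent-factor half-trek. -/
lemma exists_halfTrek_of_isSTPath {p : List (FlowNode V L)} (hp : IsSTPath DV DLV v A Z p)
    (hAZ : Disjoint A Z) :
    ∃ τ : HalfTrek DV DLV, τ.source ∈ A ∧ FlowNode.orig (Sum.inl τ.source) ∈ p ∧
      (∀ h ∈ τ.lats, FlowNode.orig (Sum.inr h) ∈ p) ∧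
      (∀ w ∈ τ.rightV, FlowNode.copy (Sum.inl w) ∈ p) ∧
      τ.target ∈ τ.rightV ∧
      (τ.target ∈ paV DV v ∨ τ.target ∈ Z) ∧
      (τ.target ∈ Z → ∃ h, τ.latent = some h ∧ τ.tail = [τ.target]) := by
  obtain ⟨hc, hh, hl, -⟩ := hp
  replace hc : p.IsChain (FlowEdge DV DLV v A Z) := hc
  match p with
  | [] => simp at hh
  | [x] =>
    simp at hh hl
    simp [hh] at hl
  | x :: y :: l =>
    obtain rfl : x = .s := by simpa using hh
    rw [List.isChain_cons_cons] at hc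
    rw [List.getLast?_cons_cons] at hl
    obtain ⟨he, hc⟩ := hc
    match y with
    | .s => simp [FlowEdge] at he
    | .t => simp [FlowEdge] at he
    | .copy _ => simp [FlowEdge] at he
    | .orig (Sum.inr _) => simp [FlowEdge] at he
    | .orig (Sum.inl a) =>
    have ha : a ∈ A := by simpa [FlowEdge] using he
    match l with
    | [] => simp at hl
    | .s :: _ => simp [FlowEdge] at hc
    | .t :: _ => simp [FlowEdge] at hc
    | .orig (Sum.inl _) :: _ => simp [FlowEdge] at hc
    | .copy (Sum.inr _) :: _ => simp [FlowEdge] at hc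
    | .copy (Sum.inl b) :: l =>
      rw [List.isChain_cons_cons] at hc
      rw [List.getLast?_cons_cons] at hl
      obtain rfl : a = b := by simpa [FlowEdge] using hc.1.1
      obtain ⟨ws, h1, h2, h3, h4⟩ := exists_observed_path l a hc.2 hl
      refine ⟨⟨a, none, ws, h1.tail, fun _ x hx => (List.isChain_cons.1 h1).1 x hx,
        by simp, by simp⟩, ha, by simp, by simp [HalfTrek.lats], ?_, ?_, h4, ?_⟩
      · intro w hw
        rcases Finset.mem_insert.1 hw with rfl | hw
        · simp
        · simp [h3 w (List.mem_toFinset.1 hw)]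
      · simp only [HalfTrek.rightV, HalfTrek.target]
        grind [List.mem_toFinset]
      · intro hz
        simp only [HalfTrek.target] at hz
        exfalso
        cases ws using List.reverseRecOn with
        | nil => exact Finset.disjoint_left.1 hAZ ha (by simpa using hz)
        | append_singleton ws x => exact h2 x (by simp) (by simpa using hz)
    | .orig (Sum.inr h) :: l =>
      rw [List.isChain_cons_cons] at hc
      rw [List.getLast?_cons_cons] at hl
      obtain ⟨he, hc⟩ := hc
      have hha : (h, a) ∈ DLV := he.2
      match l with
      | [] => simp at hl
      | .s :: _ => simp [FlowEdge] at hc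
      | .t :: _ => simp [FlowEdge] at hc
      | .orig _ :: _ => simp [FlowEdge] at hc
      | .copy (Sum.inl _) :: _ => simp [FlowEdge] at hc
      | .copy (Sum.inr k) :: l =>
      rw [List.isChain_cons_cons] at hc
      rw [List.getLast?_cons_cons] at hl
      obtain ⟨he, hc⟩ := hc
      obtain rfl : h = k := he
      match l with
      | [] => simp at hl
      | .s :: _ => simp [FlowEdge] at hc
      | .t :: _ => simp [FlowEdge] at hc
      | .orig _ :: _ => simp [FlowEdge] at hc
      | .copy (Sum.inr _) :: _ => simp [FlowEdge] at hc
      | .copy (Sum.inl b) :: l =>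
      rw [List.isChain_cons_cons] at hc
      rw [List.getLast?_cons_cons] at hl
      obtain ⟨he, hc⟩ := hc
      have hhb : (h, b) ∈ DLV := he
      obtain ⟨ws, h1, h2, h3, h4⟩ := exists_observed_path l b hc hl
      refine ⟨⟨a, some h, b :: ws, h1, by simp, fun k hk => Option.some.inj hk ▸ hha,
        fun k hk => ⟨b, rfl, Option.some.inj hk ▸ hhb⟩⟩, ha, by simp, by simp [HalfTrek.lats],
        ?_, ?_, ?_, ?_⟩
      · intro w hw
        rcases List.mem_cons.1 (List.mem_toFinset.1 hw) with rfl | hw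
        · simp
        · simp [h3 w hw]
      · simp only [HalfTrek.rightV, HalfTrek.target]
        grind [List.mem_toFinset]
      · simpa only [HalfTrek.target, List.getLastD_cons] using h4
      · intro hz
        refine ⟨h, rfl, ?_⟩
        simp only [HalfTrek.target, List.getLastD_cons] at hz ⊢
        cases ws using List.reverseRecOn with
        | nil => simp
        | append_singleton ws x => exact absurd (by simpa using hz) (h2 x (by simp))

/-- A directed path of observed nodes lifts to the copied part of the flow graph. -/
lemma isChain_copy (ws : List V) (w : V) (hc : (w :: ws).IsChain (fun a b => (a, b) ∈ DV))
    (hZ : ∀ x ∈ ws, x ∉ Z) (hl : ws.getLastD w ∈ paV DV v ∨ ws.getLastD w ∈ Z) :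
    (FlowNode.copy (Sum.inl w) :: (ws.map (fun x => FlowNode.copy (Sum.inl x)) ++
      [FlowNode.t])).IsChain (FlowEdge DV DLV v A Z) := by
  induction ws generalizing w with
  | nil => simpa [FlowEdge] using hl
  | cons u ws ih =>
    rw [List.isChain_cons_cons] at hc
    simp only [List.map_cons, List.cons_append, List.isChain_cons_cons]
    refine ⟨⟨hc.1, hZ u (by simp)⟩, ih u hc.2 (fun x hx => hZ x (by simp [hx])) ?_⟩
    simpa only [List.getLastD_cons] using hl

/-- Every half-trek starting in `A`, ending in `pa(v) ∪ Z` and entering `Z` at most along the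
edge out of its latent node gives an `s`–`t` path of the flow graph. -/
lemma exists_isSTPath_of_halfTrek (τ : HalfTrek DV DLV) (hs : τ.source ∈ A)
    (ht : τ.target ∈ paV DV v ∨ τ.target ∈ Z)
    (hn : τ.latent = none → ∀ x ∈ τ.tail, x ∉ Z) (ht' : ∀ x ∈ τ.tail.tail, x ∉ Z) :
    ∃ p : List (FlowNode V L), IsSTPath DV DLV v A Z p ∧ ∀ x ∈ p,
      x = .s ∨ x = .t ∨ x = .orig (Sum.inl τ.source) ∨
      (∃ h ∈ τ.lats, x = .orig (Sum.inr h) ∨ x = .copy (Sum.inr h)) ∨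
      ∃ w ∈ τ.rightV, x = .copy (Sum.inl w) := by
  suffices hsuff : ∃ q : List (FlowNode V L), q.IsChain (FlowEdge DV DLV v A Z) ∧
      q.head? = some .s ∧ q.getLast? = some .t ∧ ∀ x ∈ q,
      x = .s ∨ x = .t ∨ x = .orig (Sum.inl τ.source) ∨
      (∃ h ∈ τ.lats, x = .orig (Sum.inr h) ∨ x = .copy (Sum.inr h)) ∨
      ∃ w ∈ τ.rightV, x = .copy (Sum.inl w) by
    obtain ⟨q, hq, hh, hl, hm⟩ := hsuff
    obtain ⟨p, hp, hph, hpl, hpn, hps⟩ := exists_nodup_isChain q hq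
    exact ⟨p, ⟨hp, hph.trans hh, hpl.trans hl, hpn⟩, fun x hx => hm x (hps hx)⟩
  obtain ⟨a, lat, ws, hc, hsrc, hls, hlh⟩ := τ
  replace hc : ws.IsChain (fun a b => (a, b) ∈ DV) := hc
  simp only [HalfTrek.target] at *
  match lat with
  | none =>
    refine ⟨.s :: .orig (Sum.inl a) :: .copy (Sum.inl a) ::
      (ws.map (fun x => FlowNode.copy (Sum.inl x)) ++ [.t]), ?_, rfl, ?_, ?_⟩
    · simp only [List.isChain_cons_cons]
      exact ⟨hs, ⟨rfl, hs⟩,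
        isChain_copy ws a (List.isChain_cons.2 ⟨hsrc rfl, hc⟩) (hn rfl) ht⟩
    · simp [List.getLast?_cons]
    · simp [HalfTrek.rightV, HalfTrek.lats]
      grind
  | some h =>
    match ws with
    | [] => simp at hlh
    | b :: ws =>
      have hhb : (h, b) ∈ DLV := by simpa using hlh
      refine ⟨.s :: .orig (Sum.inl a) :: .orig (Sum.inr h) :: .copy (Sum.inr h) ::
        .copy (Sum.inl b) :: (ws.map (fun x => FlowNode.copy (Sum.inl x)) ++ [.t]), ?_, rfl, ?_, ?_⟩
      · simp only [List.isChain_cons_cons]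
        exact ⟨hs, ⟨hs, hls h rfl⟩, rfl, hhb, isChain_copy ws b hc ht'
          (by simpa only [List.getLastD_cons] using ht)⟩
      · simp [List.getLast?_cons]
      · simp [HalfTrek.rightV, HalfTrek.lats]
        grind

end FlowPaths

end LFG

open LFG

/-- **Theorem 9: max-flow characterization of the LF-HTC.**
Fix `v`, `H ⊆ ℒ` and `Z ⊆ ch(H) ∖ ({v} ∪ pa_V(v))` with `|Z| = |H|`, and let
`A = V ∖ (Z ∪ {v} ∪ ch(pa_ℒ(Z ∪ {v}) ∖ H))`. Then `G_flow(v, A, Z)` has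
`|pa_V(v)| + |Z|` internally vertex-disjoint simple `s`–`t` paths (i.e. the maximum
`s`–`t` flow with unit vertex capacities equals `|pa_V(v)| + |Z|`) if and only if
there is `Y ⊆ A` so that `(Y, Z, H)` satisfies the LF-HTC with respect to `v`. -/
theorem maxflow_iff_lfhtc
    {V L : Type} [Fintype V] [DecidableEq V] [Fintype L] [DecidableEq L]
    (DV : Finset (V × V)) (DLV : Finset (L × V))
    (hloop : ∀ x : V, (x, x) ∉ DV)
    (v : V) (H : Finset L) (Z : Finset V)
    (hZ : Z ⊆ chL DLV H \ insert v (paV DV v))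
    (hcard : Z.card = H.card)
    (A : Finset V)
    (hA : A = Finset.univ \ (insert v Z ∪ chL DLV (paL DLV (insert v Z) \ H))) :
    (∃ P : Fin ((paV DV v).card + Z.card) → List (FlowNode V L),
      (∀ i, IsSTPath DV DLV v A Z (P i)) ∧
      ∀ i j, i ≠ j → ∀ x, x ∈ P i → x ∈ P j → x = FlowNode.s ∨ x = FlowNode.t) ↔
    (∃ Y ⊆ A, SatisfiesLFHTC DV DLV v Y Z H) := by
  have hZv : v ∉ Z := fun h => by simpa using hZ h
  have hZpa : Disjoint Z (paV DV v) := Finset.disjoint_left.2 fun z hz hp => by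
    have := hZ hz
    simp [hp] at this
  have hAZ : Disjoint A (insert v Z) := Finset.disjoint_left.2 fun a ha hz => by
    rw [hA, Finset.mem_sdiff, Finset.mem_union] at ha
    exact ha.2 (Or.inl hz)
  have hAL : ∀ a ∈ A, ∀ h, (h, a) ∈ DLV → h ∈ paL DLV (insert v Z) → h ∈ H := by
    intro a ha h hha hp
    by_contra hH
    rw [hA, Finset.mem_sdiff, Finset.mem_union] at ha
    exact ha.2 (Or.inr (mem_chL.2 ⟨h, Finset.mem_sdiff.2 ⟨hp, hH⟩, hha⟩))
  have hAZ' : Disjoint A Z := hAZ.mono_right (Finset.subset_insert v Z)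
  have hT : (Z ∪ paV DV v).card = (paV DV v).card + Z.card := by
    rw [Finset.card_union_of_disjoint hZpa, add_comm]
  constructor
  · rintro ⟨P, hP, hdis⟩
    choose τ hsA hsrc hlat hright htr htT htZ using
      fun i => exists_halfTrek_of_isSTPath (hP i) hAZ'
    have hinj : Function.Injective fun i => (τ i).target := by
      intro i j hij
      by_contra hne
      have := hdis i j hne _ (hright i _ (htr i)) (by
        simp only at hij
        rw [hij]
        exact hright j _ (htr j))
      simp at this
    have himg : Finset.univ.image (fun i => (τ i).target) = Z ∪ paV DV v := by
      apply Finset.eq_of_subset_of_card_le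
      · intro x hx
        obtain ⟨i, -, rfl⟩ := Finset.mem_image.1 hx
        exact Finset.mem_union.2 (htT i).symm
      · rw [Finset.card_image_of_injective _ hinj, hT, Finset.card_univ, Fintype.card_fin]
    have hex : ∀ b, ∃ σ : HalfTrek DV DLV, b ∈ Z ∪ paV DV v → ∃ i, σ = τ i ∧ (τ i).target = b := by
      intro b
      by_cases hb : b ∈ Z ∪ paV DV v
      · rw [← himg] at hb
        obtain ⟨i, -, hi⟩ := Finset.mem_image.1 hb
        exact ⟨τ i, fun _ => ⟨i, rfl, hi⟩⟩
      · exact ⟨⟨v, none, [], List.isChain_nil, by simp, by simp, by simp⟩, fun h => absurd h hb⟩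
    choose f hf using hex
    have hNSI : ∀ b₁ ∈ Z ∪ paV DV v, ∀ b₂ ∈ Z ∪ paV DV v, b₁ ≠ b₂ → NSI (f b₁) (f b₂) := by
      intro b₁ hb₁ b₂ hb₂ hne
      obtain ⟨i, hi, rfl⟩ := hf b₁ hb₁
      obtain ⟨j, hj, rfl⟩ := hf b₂ hb₂
      have hij : i ≠ j := fun h => hne (by rw [h])
      rw [hi, hj]
      refine ⟨?_, ?_, ?_⟩
      · simp only [HalfTrek.leftV, Finset.disjoint_singleton]
        intro h
        simpa using hdis i j hij _ (hsrc i) (by rw [h]; exact hsrc j)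
      · refine Finset.disjoint_left.2 fun h h₁ h₂ => ?_
        simpa using hdis i j hij _ (hlat i h h₁) (hlat j h h₂)
      · refine Finset.disjoint_left.2 fun w h₁ h₂ => ?_
        simpa using hdis i j hij _ (hright i w h₁) (hright j w h₂)
    have hYA : (Z ∪ paV DV v).image (fun b => (f b).source) ⊆ A := by
      intro y hy
      obtain ⟨b, hb, rfl⟩ := Finset.mem_image.1 hy
      obtain ⟨i, hi, -⟩ := hf b hb
      simpa only [hi] using hsA i
    refine ⟨_, hYA, ?_, hZv, ?_, hcard, hZpa, hAZ.mono_left hYA, ?_, f, ⟨?_, rfl, hNSI⟩, ?_⟩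
    · exact fun h => Finset.disjoint_left.1 hAZ (hYA h) (Finset.mem_insert_self _ _)
    · rw [Finset.card_image_of_injOn, hT, hcard]
      intro b₁ hb₁ b₂ hb₂ h
      by_contra hne
      have := (hNSI b₁ hb₁ b₂ hb₂ hne).1
      simp only [HalfTrek.leftV, Finset.disjoint_singleton] at this
      exact this h
    · intro h hh
      obtain ⟨h₁, h₂⟩ := Finset.mem_inter.1 hh
      obtain ⟨y, hy, hhy⟩ := mem_paL.1 h₁
      exact hAL y (hYA hy) h hhy h₂
    · intro b hb
      obtain ⟨i, hi, hb'⟩ := hf b hb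
      rw [hi, hb']
    · intro z hz
      obtain ⟨i, hi, rfl⟩ := hf z (Finset.mem_union_left _ hz)
      obtain ⟨h, h₁, h₂⟩ := htZ i hz
      rw [hi]
      refine ⟨h, ?_, h₁, h₂⟩
      obtain ⟨x, hx, hhx⟩ := (τ i).latent_head h h₁
      obtain rfl : (τ i).target = x := by simpa [h₂] using hx
      exact hAL _ (hsA i) h ((τ i).latent_src h h₁)
        (mem_paL.2 ⟨_, Finset.mem_insert_of_mem hz, hhx⟩)
  · rintro ⟨Y, hYA, -, -, -, -, -, -, -, f, ⟨hft, hfY, hNSI⟩, hfZ⟩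
    have key : ∀ b ∈ Z ∪ paV DV v, ∃ p : List (FlowNode V L), IsSTPath DV DLV v A Z p ∧ ∀ x ∈ p,
        x = .s ∨ x = .t ∨ x = .orig (Sum.inl (f b).source) ∨
        (∃ h ∈ (f b).lats, x = .orig (Sum.inr h) ∨ x = .copy (Sum.inr h)) ∨
        ∃ w ∈ (f b).rightV, x = .copy (Sum.inl w) := by
      intro b hb
      refine exists_isSTPath_of_halfTrek (f b) ?_ ?_ ?_ ?_
      · exact hYA (hfY ▸ Finset.mem_image_of_mem (fun b => (f b).source) hb)
      · rw [hft b hb]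
        exact (Finset.mem_union.1 hb).symm
      all_goals
        by_cases hbZ : b ∈ Z
        · obtain ⟨h, -, h₁, h₂⟩ := hfZ b hbZ
          simp [h₁, h₂]
      · intro _ x hx hxZ
        obtain ⟨h, -, h₁, h₂⟩ := hfZ x hxZ
        exact Finset.disjoint_left.1
          (hNSI b hb x (Finset.mem_union_left _ hxZ) (fun h => hbZ (h ▸ hxZ))).2.2
          (mem_rightV_of_mem_tail hx) (mem_rightV_of_mem_tail (by simp [h₂]))
      · intro x hx hxZ
        obtain ⟨h, -, h₁, h₂⟩ := hfZ x hxZ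
        exact Finset.disjoint_left.1
          (hNSI b hb x (Finset.mem_union_left _ hxZ) (fun h => hbZ (h ▸ hxZ))).2.2
          (mem_rightV_of_mem_tail (List.mem_of_mem_tail hx))
          (mem_rightV_of_mem_tail (by simp [h₂]))
    choose p hp hpm using key
    let e := (Finset.equivFinOfCardEq hT).symm
    refine ⟨fun i => p (e i) (e i).2, fun i => hp _ _, ?_⟩
    intro i j hij x hi hj
    have hne : (e i : V) ≠ e j := fun h => hij (e.injective (Subtype.ext h))
    obtain ⟨h₁, h₂, h₃⟩ := hNSI _ (e i).2 _ (e j).2 hne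
    simp only [HalfTrek.leftV, Finset.disjoint_singleton] at h₁
    rw [Finset.disjoint_left] at h₂ h₃
    have hi := hpm _ _ x hi
    have hj := hpm _ _ x hj
    grind
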